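/- Let g ∈ C¹([0,1]) with √(g(x)² + g'(x)²) ≤ N₁ for all x and |g(x)| ≤ N₀ for all x. Then for every u ∈ H¹(0,1), ‖g·u − ρ_{cos,m}(g·ρ_{cos,m}(u))‖_{L²(0,1)} ≤ ((N₀ + N₁)/(πm)) ‖u‖_{H¹(0,1)}, where ρ_{cos,m} denotes the m-term cosine Fourier partial sum operator. -/

import Mathlib

open MeasureTheory

/-- `u` is an `H¹` function on `(0,1)` with weak derivative `u'`. -/
def IsH1 (u u' : ℝ → ℝ) : Prop :=
  ContinuousOn u (Set.Icc 0 1) ∧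
  IntervalIntegrable u' volume 0 1 ∧
  IntervalIntegrable (fun t => u' t ^ 2) volume 0 1 ∧
  ∀ x ∈ Set.Icc (0:ℝ) 1, u x = u 0 + ∫ t in (0:ℝ)..x, u' t

/-- The `L²(0,1)` norm. -/
noncomputable def L2norm (v : ℝ → ℝ) : ℝ :=
  Real.sqrt (∫ x in (0:ℝ)..1, v x ^ 2)

/-- The `H¹(0,1)` norm of `u` with weak derivative `u'`. -/
noncomputable def H1norm (u u' : ℝ → ℝ) : ℝ :=
  Real.sqrt ((∫ x in (0:ℝ)..1, u x ^ 2) + ∫ x in (0:ℝ)..1, u' x ^ 2)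

/-- The cosine Fourier coefficient: `û_cos(1) = ∫₀¹ u` and
`û_cos(k) = ∫₀¹ u(x) √2 cos((k-1)πx) dx` for `k ≥ 2`. -/
noncomputable def cosCoeff (u : ℝ → ℝ) (k : ℕ) : ℝ :=
  if k = 1 then ∫ x in (0:ℝ)..1, u x
  else ∫ x in (0:ℝ)..1, u x * (Real.sqrt 2 * Real.cos (((k:ℝ) - 1) * Real.pi * x))

/-- The `m`-term cosine partial sum `ρ_{cos,m}(u)`. -/
noncomputable def cosPartialSum (u : ℝ → ℝ) (m : ℕ) (x : ℝ) : ℝ :=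
  cosCoeff u 1 + ∑ k ∈ Finset.Icc 2 m,
    cosCoeff u k * (Real.sqrt 2 * Real.cos (((k:ℝ) - 1) * Real.pi * x))

lemma integral_sum_mul_sq {ι : Type*} [DecidableEq ι] (e : ι → ℝ → ℝ) (s : Finset ι) (c : ι → ℝ)
    (he : ∀ i, Continuous (e i))
    (orth : ∀ i ∈ s, ∀ j ∈ s, ∫ x in (0:ℝ)..1, e i x * e j x = if i = j then 1 else 0) :
    ∫ x in (0:ℝ)..1, (∑ i ∈ s, c i * e i x) ^ 2 = ∑ i ∈ s, c i ^ 2 := by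
  have h1 : ∀ x, (∑ i ∈ s, c i * e i x) ^ 2 =
      ∑ i ∈ s, ∑ j ∈ s, c i * c j * (e i x * e j x) := by
    intro x
    rw [sq, Finset.sum_mul_sum]
    exact Finset.sum_congr rfl fun i _ => Finset.sum_congr rfl fun j _ => by ring
  simp_rw [h1]
  rw [intervalIntegral.integral_finsetSum
    (fun i _ => (by fun_prop : Continuous _).intervalIntegrable _ _)]
  refine Finset.sum_congr rfl fun i hi => ?_
  rw [intervalIntegral.integral_finsetSum
    (fun i _ => (by fun_prop : Continuous _).intervalIntegrable _ _)]
  simp_rw [intervalIntegral.integral_const_mul]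
  rw [Finset.sum_congr rfl fun j hj => by rw [orth i hi j hj]]
  simp [hi, sq]

/-- **Bessel's identity** for a finite orthonormal system of continuous functions on `[0,1]`. -/
lemma integral_sub_sum_mul_sq {ι : Type*} [DecidableEq ι] (e : ι → ℝ → ℝ) (s : Finset ι)
    (he : ∀ i, Continuous (e i))
    (orth : ∀ i ∈ s, ∀ j ∈ s, ∫ x in (0:ℝ)..1, e i x * e j x = if i = j then 1 else 0)
    {f : ℝ → ℝ} (hf : IntervalIntegrable f volume 0 1)
    (hf2 : IntervalIntegrable (fun x => f x ^ 2) volume 0 1) :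
    ∫ x in (0:ℝ)..1, (f x - ∑ i ∈ s, (∫ y in (0:ℝ)..1, f y * e i y) * e i x) ^ 2 =
      (∫ x in (0:ℝ)..1, f x ^ 2) - ∑ i ∈ s, (∫ y in (0:ℝ)..1, f y * e i y) ^ 2 := by
  set c : ι → ℝ := fun i => ∫ y in (0:ℝ)..1, f y * e i y with hc
  have hfe : ∀ i, IntervalIntegrable (fun x => f x * e i x) volume 0 1 :=
    fun i => hf.mul_continuousOn (he i).continuousOn
  have h1 : ∀ x, (f x - ∑ i ∈ s, c i * e i x) ^ 2 =
      f x ^ 2 - ∑ i ∈ s, 2 * c i * (f x * e i x) + (∑ i ∈ s, c i * e i x) ^ 2 := by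
    intro x
    have : ∑ i ∈ s, 2 * c i * (f x * e i x) = 2 * f x * ∑ i ∈ s, c i * e i x := by
      rw [Finset.mul_sum]
      exact Finset.sum_congr rfl fun i _ => by ring
    rw [this]; ring
  have hs : IntervalIntegrable (fun x => ∑ i ∈ s, 2 * c i * (f x * e i x)) volume 0 1 := by
    have := IntervalIntegrable.sum s (f := fun i x => 2 * c i * (f x * e i x))
      (fun i _ => (hfe i).const_mul (2 * c i))
    convert! this using 1
    ext x
    simp
  change ∫ x in (0:ℝ)..1, (f x - ∑ i ∈ s, c i * e i x) ^ 2 = _ - ∑ i ∈ s, c i ^ 2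
  simp_rw [h1]
  rw [intervalIntegral.integral_add (hf2.sub hs)
      ((by fun_prop : Continuous _).intervalIntegrable _ _),
    intervalIntegral.integral_sub hf2 hs, integral_sum_mul_sq e s c he orth,
    intervalIntegral.integral_finsetSum (fun i _ => (hfe i).const_mul (2 * c i))]
  simp_rw [intervalIntegral.integral_const_mul]
  have : ∑ i ∈ s, 2 * c i * c i = 2 * ∑ i ∈ s, c i ^ 2 := by
    rw [Finset.mul_sum]
    exact Finset.sum_congr rfl fun i _ => by ring
  change _ - ∑ i ∈ s, 2 * c i * c i + _ = _
  rw [this]; ring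

lemma sum_sq_integral_mul_le {ι : Type*} [DecidableEq ι] (e : ι → ℝ → ℝ) (s : Finset ι)
    (he : ∀ i, Continuous (e i))
    (orth : ∀ i ∈ s, ∀ j ∈ s, ∫ x in (0:ℝ)..1, e i x * e j x = if i = j then 1 else 0)
    {f : ℝ → ℝ} (hf : IntervalIntegrable f volume 0 1)
    (hf2 : IntervalIntegrable (fun x => f x ^ 2) volume 0 1) :
    ∑ i ∈ s, (∫ y in (0:ℝ)..1, f y * e i y) ^ 2 ≤ ∫ x in (0:ℝ)..1, f x ^ 2 := by
  have h := integral_sub_sum_mul_sq e s he orth hf hf2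
  have : 0 ≤ ∫ x in (0:ℝ)..1, (f x - ∑ i ∈ s, (∫ y in (0:ℝ)..1, f y * e i y) * e i x) ^ 2 :=
    intervalIntegral.integral_nonneg zero_le_one fun _ _ => sq_nonneg _
  linarith

/-- The orthonormal cosine system on `[0,1]`, indexed by the frequency. -/
noncomputable def cosBasis (n : ℕ) (x : ℝ) : ℝ :=
  if n = 0 then 1 else Real.sqrt 2 * Real.cos (n * Real.pi * x)

/-- The orthonormal sine system on `[0,1]` (with the zero function at frequency `0`). -/
noncomputable def sinBasis (n : ℕ) (x : ℝ) : ℝ :=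
  Real.sqrt 2 * Real.sin (n * Real.pi * x)

@[fun_prop]
lemma continuous_cosBasis (n : ℕ) : Continuous (cosBasis n) := by
  unfold cosBasis
  split_ifs <;> fun_prop

@[fun_prop]
lemma continuous_sinBasis (n : ℕ) : Continuous (sinBasis n) := by
  unfold sinBasis
  fun_prop

lemma hasDerivAt_cosBasis (n : ℕ) (x : ℝ) :
    HasDerivAt (cosBasis n) (-(n * Real.pi) * sinBasis n x) x := by
  rcases Nat.eq_zero_or_pos n with rfl | hn
  · have : cosBasis 0 = fun _ => 1 := by ext; simp [cosBasis]
    simpa [this] using hasDerivAt_const x (1:ℝ)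
  · have : cosBasis n = fun x => Real.sqrt 2 * Real.cos (n * Real.pi * x) := by
      ext; simp [cosBasis, hn.ne']
    rw [this]
    convert! (((hasDerivAt_id x).const_mul (n * Real.pi)).cos).const_mul (Real.sqrt 2) using 1
    simp only [sinBasis, id]
    ring

lemma integral_cos_int_mul_pi (k : ℤ) :
    ∫ x in (0:ℝ)..1, Real.cos (k * Real.pi * x) = if k = 0 then 1 else 0 := by
  split_ifs with hk
  · simp [hk]
  · have hk' : (k:ℝ) * Real.pi ≠ 0 := mul_ne_zero (by exact_mod_cast hk) Real.pi_ne_zero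
    rw [intervalIntegral.integral_comp_mul_left (fun y => Real.cos y) hk', integral_cos]
    simp [Real.sin_int_mul_pi]

lemma integral_cosBasis_mul (i j : ℕ) :
    ∫ x in (0:ℝ)..1, cosBasis i x * cosBasis j x = if i = j then 1 else 0 := by
  have h2 : Real.sqrt 2 * Real.sqrt 2 = 2 := Real.mul_self_sqrt (by norm_num)
  have hi := fun k : ℕ => integral_cos_int_mul_pi (k : ℤ)
  rcases Nat.eq_zero_or_pos i with rfl | hi0 <;> rcases Nat.eq_zero_or_pos j with rfl | hj0
  · simp [cosBasis]
  · have := hi j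
    push_cast at this
    simp [cosBasis, hj0.ne', hj0.ne, this]
  · have := hi i
    push_cast at this
    simp [cosBasis, hi0.ne', this]
  · have h : ∀ x, cosBasis i x * cosBasis j x =
        Real.cos (((i - j : ℤ) : ℝ) * Real.pi * x) + Real.cos (((i + j : ℤ) : ℝ) * Real.pi * x) := by
      intro x
      simp only [cosBasis, hi0.ne', hj0.ne', if_false]
      push_cast
      rw [show ((i:ℝ) - j) * Real.pi * x = i * Real.pi * x - j * Real.pi * x by ring,
        show ((i:ℝ) + j) * Real.pi * x = i * Real.pi * x + j * Real.pi * x by ring,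
        Real.cos_sub, Real.cos_add]
      linear_combination (Real.cos (i * Real.pi * x) * Real.cos (j * Real.pi * x)) * h2
    simp_rw [h]
    rw [intervalIntegral.integral_add ((by fun_prop : Continuous _).intervalIntegrable _ _)
      ((by fun_prop : Continuous _).intervalIntegrable _ _), integral_cos_int_mul_pi,
      integral_cos_int_mul_pi]
    have h3 : (i:ℤ) + j ≠ 0 := by omega
    have h4 : (i:ℤ) - j = 0 ↔ i = j := by omega
    simp [h3, h4]

lemma integral_sinBasis_mul {i j : ℕ} (hi0 : 1 ≤ i) :
    ∫ x in (0:ℝ)..1, sinBasis i x * sinBasis j x = if i = j then 1 else 0 := by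
  have h2 : Real.sqrt 2 * Real.sqrt 2 = 2 := Real.mul_self_sqrt (by norm_num)
  have h : ∀ x, sinBasis i x * sinBasis j x =
      Real.cos (((i - j : ℤ) : ℝ) * Real.pi * x) - Real.cos (((i + j : ℤ) : ℝ) * Real.pi * x) := by
    intro x
    simp only [sinBasis]
    push_cast
    rw [show ((i:ℝ) - j) * Real.pi * x = i * Real.pi * x - j * Real.pi * x by ring,
      show ((i:ℝ) + j) * Real.pi * x = i * Real.pi * x + j * Real.pi * x by ring,
      Real.cos_sub, Real.cos_add]
    linear_combination (Real.sin (i * Real.pi * x) * Real.sin (j * Real.pi * x)) * h2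
  simp_rw [h]
  rw [intervalIntegral.integral_sub ((by fun_prop : Continuous _).intervalIntegrable _ _)
    ((by fun_prop : Continuous _).intervalIntegrable _ _), integral_cos_int_mul_pi,
    integral_cos_int_mul_pi]
  have h3 : (i:ℤ) + j ≠ 0 := by omega
  have h4 : (i:ℤ) - j = 0 ↔ i = j := by omega
  simp [h3, h4]

lemma cosPartialSum_eq_sum_range (u : ℝ → ℝ) {m : ℕ} (hm : 1 ≤ m) (x : ℝ) :
    cosPartialSum u m x =
      ∑ n ∈ Finset.range m, (∫ y in (0:ℝ)..1, u y * cosBasis n y) * cosBasis n x := by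
  obtain ⟨m, rfl⟩ := Nat.exists_eq_add_of_le' hm
  rw [Finset.sum_range_succ', cosPartialSum, add_comm (cosCoeff u 1)]
  congr 1
  · have : Finset.Icc 2 (m + 1) = Finset.Ico (0 + 2) (m + 2) := by ext; simp; omega
    rw [this, ← Finset.sum_Ico_add', ← Finset.range_eq_Ico]
    refine Finset.sum_congr rfl fun n _ => ?_
    have h : (((n + 2 : ℕ) : ℝ) - 1) = ((n + 1 : ℕ) : ℝ) := by push_cast; ring
    simp only [cosCoeff, cosBasis, h, Nat.succ_ne_zero, if_false]
    simp
  · simp [cosCoeff, cosBasis]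

lemma integral_add_comp_neg {f : ℝ → ℂ} (hf : ContinuousOn f (Set.Icc (-1) 1)) :
    ∫ x in (-1:ℝ)..1, f x = ∫ x in (0:ℝ)..1, (f x + f (-x)) := by
  have h1 : IntervalIntegrable f volume (-1) 0 :=
    (hf.mono (Set.Icc_subset_Icc le_rfl zero_le_one)).intervalIntegrable_of_Icc (by norm_num)
  have h2 : IntervalIntegrable f volume 0 1 :=
    (hf.mono (Set.Icc_subset_Icc (by norm_num) le_rfl)).intervalIntegrable_of_Icc (by norm_num)
  have h3 : IntervalIntegrable (fun x => f (-x)) volume 0 1 := by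
    have := h1.symm.comp_sub_left 0
    simpa using this
  rw [← intervalIntegral.integral_add_adjacent_intervals h1 h2, intervalIntegral.integral_add h2 h3,
    intervalIntegral.integral_comp_neg]
  simp [add_comm]

/-- **Parseval's identity** for the cosine system on `[0,1]`. -/
lemma hasSum_sq_integral_mul_cosBasis {v : ℝ → ℝ} (hv : ContinuousOn v (Set.Icc 0 1)) :
    HasSum (fun n => (∫ y in (0:ℝ)..1, v y * cosBasis n y) ^ 2) (∫ x in (0:ℝ)..1, v x ^ 2) := by
  set F : ℝ → ℂ := fun x => (v |x| : ℂ) with hF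
  have hFc : ContinuousOn F (Set.Icc (-1) 1) := by
    refine Complex.continuous_ofReal.comp_continuousOn
      (hv.comp continuous_abs.continuousOn fun x hx => ⟨abs_nonneg x, abs_le.2 hx⟩)
  have hab : (-1:ℝ) < 1 := by norm_num
  have hL2 : MemLp F 2 (volume.restrict (Set.Ioc (-1) 1)) := by
    obtain ⟨C, hC⟩ := isCompact_Icc.exists_bound_of_continuousOn hFc
    refine MemLp.of_bound ((hFc.mono Set.Ioc_subset_Icc_self).aestronglyMeasurable
      measurableSet_Ioc) C ?_
    filter_upwards [ae_restrict_mem measurableSet_Ioc] with x hx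
    exact hC x (Set.Ioc_subset_Icc_self hx)
  set a : ℤ → ℝ := fun n => ∫ x in (0:ℝ)..1, v x * Real.cos (n * Real.pi * x) with ha
  have hcoeff : ∀ n : ℤ, fourierCoeffOn hab F n = a n := by
    intro n
    rw [fourierCoeffOn_eq_integral, integral_add_comp_neg]
    · rw [ha, ← intervalIntegral.integral_ofReal, ← intervalIntegral.integral_smul]
      refine intervalIntegral.integral_congr fun x hx => ?_
      rw [Set.uIcc_of_le zero_le_one] at hx
      simp only [fourier_coe_apply, hF, abs_neg, abs_of_nonneg hx.1, smul_eq_mul]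
      push_cast
      rw [Complex.cos, Complex.real_smul]
      have e1 : 2 * (Real.pi:ℂ) * Complex.I * (-n) * x / (1 - -1) = -(n * Real.pi * x) * Complex.I := by
        ring
      have e2 : 2 * (Real.pi:ℂ) * Complex.I * (-n) * -x / (1 - -1) = (n * Real.pi * x) * Complex.I := by
        ring
      rw [e1, e2]
      push_cast
      ring
    · simp_rw [fourier_coe_apply]
      have he : Continuous fun x : ℝ =>
          Complex.exp (2 * Real.pi * Complex.I * ((-n : ℤ) : ℂ) * x / ((1 - -1 : ℝ) : ℂ)) := by
        fun_prop
      exact he.continuousOn.smul hFc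
  have hsum := hasSum_sq_fourierCoeffOn hab hL2
  have hint : ((1:ℝ) - -1)⁻¹ • ∫ x in (-1:ℝ)..1, ‖F x‖ ^ 2 = ∫ x in (0:ℝ)..1, v x ^ 2 := by
    have hc : ContinuousOn (fun x => (((v |x|) ^ 2 : ℝ) : ℂ)) (Set.Icc (-1) 1) := by
      refine (hFc.pow 2).congr fun x _ => ?_
      simp [hF]
    have h := integral_add_comp_neg hc
    rw [intervalIntegral.integral_ofReal] at h
    have h' : ∫ x in (0:ℝ)..1, ((((v |x|) ^ 2 : ℝ) : ℂ) + (((v |-x|) ^ 2 : ℝ) : ℂ)) =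
        ((2 * ∫ x in (0:ℝ)..1, v x ^ 2 : ℝ) : ℂ) := by
      rw [← intervalIntegral.integral_const_mul, ← intervalIntegral.integral_ofReal]
      refine intervalIntegral.integral_congr fun x hx => ?_
      rw [Set.uIcc_of_le zero_le_one] at hx
      simp only [abs_neg, abs_of_nonneg hx.1]
      push_cast
      ring
    rw [h'] at h
    have h'' := Complex.ofReal_injective h
    simp only [hF, Complex.norm_real, Real.norm_eq_abs, sq_abs, smul_eq_mul]
    rw [h'']
    ring
  rw [hint] at hsum
  simp_rw [hcoeff, Complex.norm_real, Real.norm_eq_abs, sq_abs] at hsum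
  have hneg : ∀ n : ℤ, a (-n) = a n := by
    intro n
    simp [ha]
  have h2 : Real.sqrt 2 ^ 2 = 2 := Real.sq_sqrt (by norm_num)
  have hnat := hsum.nat_add_neg
  have h0 : HasSum (fun n : ℕ => if n = 0 then a 0 ^ 2 else 0) (a 0 ^ 2) := hasSum_ite_eq 0 _
  convert! hnat.sub h0 using 1
  · funext n
    rcases Nat.eq_zero_or_pos n with rfl | hn
    · simp [cosBasis, ha]
    · have : ∫ y in (0:ℝ)..1, v y * cosBasis n y = Real.sqrt 2 * a n := by
        rw [ha, ← intervalIntegral.integral_const_mul]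
        refine intervalIntegral.integral_congr fun x _ => ?_
        simp only [cosBasis, hn.ne', if_false]
        push_cast
        ring
      rw [this, hneg, if_neg hn.ne', mul_pow, h2]
      ring
  · exact (add_sub_cancel_right _ _).symm

lemma IsH1.integral_mul_sinBasis {v v' : ℝ → ℝ} (hv : IsH1 v v') (n : ℕ) :
    ∫ y in (0:ℝ)..1, v' y * sinBasis n y =
      -(n * Real.pi) * ∫ y in (0:ℝ)..1, v y * cosBasis n y := by
  rcases Nat.eq_zero_or_pos n with rfl | hn
  · simp [sinBasis]
  obtain ⟨-, hint, -, hrep⟩ := hv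
  set V : ℝ → ℝ := fun x => (∫ t in (0:ℝ)..x, v' t) + v 0 with hV
  have hVac : AbsolutelyContinuousOnInterval V 0 1 :=
    (hint.absolutelyContinuousOnInterval_intervalIntegral (by simp)).add
      (contDiff_const.contDiffOn.absolutelyContinuousOnInterval)
  have hsin : ContDiff ℝ 1 (sinBasis n) := by
    unfold sinBasis
    fun_prop
  have hd : ∀ x, deriv (sinBasis n) x = n * Real.pi * cosBasis n x := by
    intro x
    refine HasDerivAt.deriv ?_
    convert! (((hasDerivAt_id x).const_mul (n * Real.pi)).sin).const_mul (Real.sqrt 2) using 1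
    simp only [cosBasis, hn.ne', if_false, id]
    ring
  have key := hVac.integral_mul_deriv_eq_deriv_mul
    hsin.contDiffOn.absolutelyContinuousOnInterval
  have hs1 : sinBasis n 1 = 0 := by simp [sinBasis, Real.sin_nat_mul_pi]
  have hs0 : sinBasis n 0 = 0 := by simp [sinBasis]
  have hl : ∫ x in (0:ℝ)..1, V x * deriv (sinBasis n) x =
      n * Real.pi * ∫ y in (0:ℝ)..1, v y * cosBasis n y := by
    rw [← intervalIntegral.integral_const_mul]
    refine intervalIntegral.integral_congr fun x hx => ?_
    rw [Set.uIcc_of_le zero_le_one] at hx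
    simp only [hd, hrep x hx, hV]
    ring
  have hr : ∫ x in (0:ℝ)..1, deriv V x * sinBasis n x =
      ∫ y in (0:ℝ)..1, v' y * sinBasis n y := by
    refine intervalIntegral.integral_congr_ae ?_
    filter_upwards [hint.ae_hasDerivAt_integral] with x hx hx1
    rw [((hx (Set.uIoc_subset_uIcc hx1) 0 (by simp)).add_const (v 0)).deriv]
  rw [hl, hr, hs1, hs0] at key
  linarith

/-- Tail estimate for the cosine partial sums of an `H¹` function. -/
lemma IsH1.integral_sub_cosPartialSum_sq_le {v v' : ℝ → ℝ} (hv : IsH1 v v') {m : ℕ} (hm : 1 ≤ m) :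
    ∫ x in (0:ℝ)..1, (v x - cosPartialSum v m x) ^ 2 ≤
      (∫ x in (0:ℝ)..1, v' x ^ 2) / (Real.pi * m) ^ 2 := by
  have hc := hv.1
  have hm' : (0:ℝ) < m := by exact_mod_cast hm
  simp_rw [cosPartialSum_eq_sum_range v hm]
  rw [integral_sub_sum_mul_sq cosBasis _ continuous_cosBasis
    (fun i _ j _ => integral_cosBasis_mul i j)
    (hc.intervalIntegrable_of_Icc zero_le_one) ((hc.pow 2).intervalIntegrable_of_Icc zero_le_one)]
  refine le_of_tendsto
    ((hasSum_sq_integral_mul_cosBasis hc).tendsto_sum_nat.sub_const _) ?_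
  filter_upwards [Filter.eventually_ge_atTop m] with M hM
  rw [← Finset.sum_Ico_eq_sub _ hM]
  have hB := sum_sq_integral_mul_le sinBasis (Finset.Ico m M) continuous_sinBasis
    (fun i hi j _ => integral_sinBasis_mul (hm.trans (Finset.mem_Ico.1 hi).1)) hv.2.1 hv.2.2.1
  rw [le_div_iff₀ (by positivity), Finset.sum_mul]
  refine (Finset.sum_le_sum fun n hn => ?_).trans hB
  rw [hv.integral_mul_sinBasis, mul_comm, mul_pow (-(n * Real.pi)), neg_sq, mul_comm (n:ℝ)]
  have : (m:ℝ) ≤ n := by exact_mod_cast (Finset.mem_Ico.1 hn).1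
  gcongr

/-- The derivative of the cosine partial sum of `v` is the sine partial sum of `v'`. -/
lemma IsH1.hasDerivAt_cosPartialSum {v v' : ℝ → ℝ} (hv : IsH1 v v') {m : ℕ} (hm : 1 ≤ m) (x : ℝ) :
    HasDerivAt (cosPartialSum v m)
      (∑ n ∈ Finset.range m, (∫ y in (0:ℝ)..1, v' y * sinBasis n y) * sinBasis n x) x := by
  rw [funext (cosPartialSum_eq_sum_range v hm)]
  have h := HasDerivAt.fun_sum (u := Finset.range m) fun n _ =>
    (hasDerivAt_cosBasis n x).const_mul (∫ y in (0:ℝ)..1, v y * cosBasis n y)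
  convert! h using 1
  refine Finset.sum_congr rfl fun n _ => ?_
  rw [hv.integral_mul_sinBasis]
  ring

lemma IsH1.integral_cosPartialSum_sq_le {v v' : ℝ → ℝ} (hv : IsH1 v v') {m : ℕ} (hm : 1 ≤ m) :
    ∫ x in (0:ℝ)..1, cosPartialSum v m x ^ 2 ≤ ∫ x in (0:ℝ)..1, v x ^ 2 := by
  have orth := fun i (_ : i ∈ Finset.range m) j (_ : j ∈ Finset.range m) =>
    integral_cosBasis_mul i j
  simp_rw [cosPartialSum_eq_sum_range v hm]
  rw [integral_sum_mul_sq cosBasis _ _ continuous_cosBasis orth]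
  exact sum_sq_integral_mul_le cosBasis _ continuous_cosBasis orth
    (hv.1.intervalIntegrable_of_Icc zero_le_one)
    ((hv.1.pow 2).intervalIntegrable_of_Icc zero_le_one)

lemma integral_sum_sinBasis_sq_le {f : ℝ → ℝ} (hf : IntervalIntegrable f volume 0 1)
    (hf2 : IntervalIntegrable (fun x => f x ^ 2) volume 0 1) (m : ℕ) :
    ∫ x in (0:ℝ)..1,
        (∑ n ∈ Finset.range m, (∫ y in (0:ℝ)..1, f y * sinBasis n y) * sinBasis n x) ^ 2 ≤
      ∫ x in (0:ℝ)..1, f x ^ 2 := by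
  have orth := fun i (hi : i ∈ Finset.Ico 1 m) j (_ : j ∈ Finset.Ico 1 m) =>
    integral_sinBasis_mul (j := j) (Finset.mem_Ico.1 hi).1
  have h : ∀ x, ∑ n ∈ Finset.range m, (∫ y in (0:ℝ)..1, f y * sinBasis n y) * sinBasis n x =
      ∑ n ∈ Finset.Ico 1 m, (∫ y in (0:ℝ)..1, f y * sinBasis n y) * sinBasis n x := by
    intro x
    refine (Finset.sum_subset (fun n hn => ?_) fun n hn hn' => ?_).symm
    · exact Finset.mem_range.2 (Finset.mem_Ico.1 hn).2
    · have : n = 0 := by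
        simp only [Finset.mem_range, Finset.mem_Ico] at hn hn'
        omega
      simp [this, sinBasis]
  simp_rw [h]
  rw [integral_sum_mul_sq sinBasis _ _ continuous_sinBasis orth]
  exact sum_sq_integral_mul_le sinBasis _ continuous_sinBasis orth hf hf2

lemma isH1_of_hasDerivWithinAt {v v' : ℝ → ℝ}
    (hv : ∀ x ∈ Set.Icc (0:ℝ) 1, HasDerivWithinAt v (v' x) (Set.Icc 0 1) x)
    (hv' : ContinuousOn v' (Set.Icc 0 1)) : IsH1 v v' := by
  have hc : ContinuousOn v (Set.Icc 0 1) := fun x hx => (hv x hx).continuousWithinAt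
  refine ⟨hc, hv'.intervalIntegrable_of_Icc zero_le_one,
    (hv'.pow 2).intervalIntegrable_of_Icc zero_le_one, fun x hx => ?_⟩
  have hsub : Set.Icc 0 x ⊆ Set.Icc (0:ℝ) 1 := Set.Icc_subset_Icc le_rfl hx.2
  rw [intervalIntegral.integral_eq_sub_of_hasDerivAt_of_le hx.1 (hc.mono hsub)
    (fun y hy => (hv y ⟨hy.1.le, hy.2.le.trans hx.2⟩).hasDerivAt
      (Icc_mem_nhds hy.1 (hy.2.trans_le hx.2)))
    ((hv'.mono hsub).intervalIntegrable_of_Icc hx.1)]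
  ring

/-- Minkowski's inequality for continuous functions on `[0,1]`. -/
lemma L2norm_add_le {a b : ℝ → ℝ} (ha : ContinuousOn a (Set.Icc 0 1))
    (hb : ContinuousOn b (Set.Icc 0 1)) {α β : ℝ} (hα : 0 ≤ α) (hβ : 0 ≤ β)
    (haα : ∫ x in (0:ℝ)..1, a x ^ 2 ≤ α ^ 2) (hbβ : ∫ x in (0:ℝ)..1, b x ^ 2 ≤ β ^ 2) :
    L2norm (fun x => a x + b x) ≤ α + β := by
  refine le_of_forall_pos_le_add fun ε hε => ?_
  have hα' : 0 < α + ε / 2 := by positivity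
  have hβ' : 0 < β + ε / 2 := by positivity
  have haα' : ∫ x in (0:ℝ)..1, a x ^ 2 ≤ (α + ε / 2) ^ 2 := haα.trans (by gcongr; linarith)
  have hbβ' : ∫ x in (0:ℝ)..1, b x ^ 2 ≤ (β + ε / 2) ^ 2 := hbβ.trans (by gcongr; linarith)
  rw [show α + β + ε = (α + ε / 2) + (β + ε / 2) by ring]
  generalize α + ε / 2 = p at *
  generalize β + ε / 2 = q at *
  refine Real.sqrt_le_iff.2 ⟨by positivity, ?_⟩
  have hia : IntervalIntegrable (fun x => a x ^ 2) volume 0 1 :=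
    (ha.pow 2).intervalIntegrable_of_Icc zero_le_one
  have hib : IntervalIntegrable (fun x => b x ^ 2) volume 0 1 :=
    (hb.pow 2).intervalIntegrable_of_Icc zero_le_one
  have h : ∫ x in (0:ℝ)..1, p * q * (a x + b x) ^ 2 ≤
      ∫ x in (0:ℝ)..1, ((p + q) * q * a x ^ 2 + (p + q) * p * b x ^ 2) := by
    refine intervalIntegral.integral_mono_on zero_le_one
      ((((ha.add hb).pow 2).intervalIntegrable_of_Icc zero_le_one).const_mul _)
      ((hia.const_mul _).add (hib.const_mul _)) fun x _ => ?_
    nlinarith [sq_nonneg (q * a x - p * b x)]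
  rw [intervalIntegral.integral_add (hia.const_mul _) (hib.const_mul _)] at h
  simp only [intervalIntegral.integral_const_mul] at h
  have h1 := mul_le_mul_of_nonneg_left haα' (by positivity : 0 ≤ (p + q) * q)
  have h2 := mul_le_mul_of_nonneg_left hbβ' (by positivity : 0 ≤ (p + q) * p)
  refine le_of_mul_le_mul_left ?_ (mul_pos hα' hβ')
  calc _ ≤ _ := h
    _ ≤ (p + q) * q * p ^ 2 + (p + q) * p * q ^ 2 := add_le_add h1 h2
    _ = _ := by ring

/-- For `g ∈ C¹([0,1])` with `√(g² + g'²) ≤ N₁` and `|g| ≤ N₀` on `[0,1]`, and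
`u ∈ H¹(0,1)`, the truncation defect satisfies
`‖g·u − ρ_{cos,m}(g·ρ_{cos,m}(u))‖_{L²} ≤ ((N₀+N₁)/(πm)) ‖u‖_{H¹}`. -/
theorem truncation_defect_estimate (g g' : ℝ → ℝ)
    (hg : ∀ x ∈ Set.Icc (0:ℝ) 1, HasDerivWithinAt g (g' x) (Set.Icc 0 1) x)
    (hg' : ContinuousOn g' (Set.Icc 0 1))
    (N₀ N₁ : ℝ)
    (hN₁ : ∀ x ∈ Set.Icc (0:ℝ) 1, Real.sqrt (g x ^ 2 + g' x ^ 2) ≤ N₁)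
    (hN₀ : ∀ x ∈ Set.Icc (0:ℝ) 1, |g x| ≤ N₀)
    (u u' : ℝ → ℝ) (hu : IsH1 u u') (m : ℕ) (hm : 1 ≤ m) :
    L2norm (fun x => g x * u x -
        cosPartialSum (fun y => g y * cosPartialSum u m y) m x) ≤
      ((N₀ + N₁) / (Real.pi * m)) * H1norm u u' := by
  have hm' : (0:ℝ) < m := by exact_mod_cast hm
  have hgc : ContinuousOn g (Set.Icc 0 1) := fun x hx => (hg x hx).continuousWithinAt
  have hN₀0 : 0 ≤ N₀ := (abs_nonneg _).trans (hN₀ 0 (by simp))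
  have hN₁0 : 0 ≤ N₁ := (Real.sqrt_nonneg _).trans (hN₁ 0 (by simp))
  set r := cosPartialSum u m with hr
  set r' : ℝ → ℝ := fun x =>
    ∑ n ∈ Finset.range m, (∫ y in (0:ℝ)..1, u' y * sinBasis n y) * sinBasis n x with hr'
  have hder : ∀ x, HasDerivAt r (r' x) x := hu.hasDerivAt_cosPartialSum hm
  have hrc : Continuous r := continuous_iff_continuousAt.2 fun x => (hder x).continuousAt
  have hr'c : Continuous r' := by fun_prop
  have hv : IsH1 (fun y => g y * r y) (fun y => g' y * r y + g y * r' y) :=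
    isH1_of_hasDerivWithinAt (fun x hx => (hg x hx).mul (hder x).hasDerivWithinAt)
      ((hg'.mul hrc.continuousOn).add (hgc.mul hr'c.continuousOn))
  have hρc : Continuous (cosPartialSum (fun y => g y * r y) m) :=
    continuous_iff_continuousAt.2 fun x => (hv.hasDerivAt_cosPartialSum hm x).continuousAt
  have hu0 : 0 ≤ ∫ x in (0:ℝ)..1, u x ^ 2 :=
    intervalIntegral.integral_nonneg zero_le_one fun _ _ => sq_nonneg _
  have hu'0 : 0 ≤ ∫ x in (0:ℝ)..1, u' x ^ 2 :=
    intervalIntegral.integral_nonneg zero_le_one fun _ _ => sq_nonneg _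
  have hH : H1norm u u' ^ 2 = (∫ x in (0:ℝ)..1, u x ^ 2) + ∫ x in (0:ℝ)..1, u' x ^ 2 :=
    Real.sq_sqrt (add_nonneg hu0 hu'0)
  have hH0 : 0 ≤ H1norm u u' := Real.sqrt_nonneg _
  have hA : ∫ x in (0:ℝ)..1, (g x * (u x - r x)) ^ 2 ≤ (N₀ / (Real.pi * m) * H1norm u u') ^ 2 := by
    have hd : ContinuousOn (fun x => u x - r x) (Set.Icc 0 1) := hu.1.sub hrc.continuousOn
    calc ∫ x in (0:ℝ)..1, (g x * (u x - r x)) ^ 2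
        ≤ ∫ x in (0:ℝ)..1, N₀ ^ 2 * (u x - r x) ^ 2 := by
          refine intervalIntegral.integral_mono_on zero_le_one
            (((hgc.mul hd).pow 2).intervalIntegrable_of_Icc zero_le_one)
            (((hd.pow 2).intervalIntegrable_of_Icc zero_le_one).const_mul _) fun x hx => ?_
          rw [mul_pow]
          exact mul_le_mul_of_nonneg_right (sq_le_sq.2 ((hN₀ x hx).trans (le_abs_self _)))
            (sq_nonneg _)
      _ = N₀ ^ 2 * ∫ x in (0:ℝ)..1, (u x - r x) ^ 2 := intervalIntegral.integral_const_mul _ _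
      _ ≤ N₀ ^ 2 * ((∫ x in (0:ℝ)..1, u' x ^ 2) / (Real.pi * m) ^ 2) := by
          gcongr
          exact hu.integral_sub_cosPartialSum_sq_le hm
      _ ≤ N₀ ^ 2 * (H1norm u u' ^ 2 / (Real.pi * m) ^ 2) := by
          gcongr
          linarith
      _ = _ := by ring
  have hB : ∫ x in (0:ℝ)..1, (g x * r x - cosPartialSum (fun y => g y * r y) m x) ^ 2 ≤
      (N₁ / (Real.pi * m) * H1norm u u') ^ 2 := by
    have hir : IntervalIntegrable (fun x => r x ^ 2) volume 0 1 :=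
      (hrc.pow 2).intervalIntegrable 0 1
    have hir' : IntervalIntegrable (fun x => r' x ^ 2) volume 0 1 :=
      (hr'c.pow 2).intervalIntegrable 0 1
    have hv' : ∫ x in (0:ℝ)..1, (g' x * r x + g x * r' x) ^ 2 ≤ N₁ ^ 2 * H1norm u u' ^ 2 := by
      calc ∫ x in (0:ℝ)..1, (g' x * r x + g x * r' x) ^ 2
          ≤ ∫ x in (0:ℝ)..1, N₁ ^ 2 * (r x ^ 2 + r' x ^ 2) := by
            refine intervalIntegral.integral_mono_on zero_le_one hv.2.2.1
              ((hir.add hir').const_mul _) fun x hx => ?_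
            have h1 : g x ^ 2 + g' x ^ 2 ≤ N₁ ^ 2 := (Real.sqrt_le_left hN₁0).1 (hN₁ x hx)
            have h2 := mul_le_mul_of_nonneg_right h1 (by positivity : 0 ≤ r x ^ 2 + r' x ^ 2)
            nlinarith [sq_nonneg (g x * r x - g' x * r' x)]
        _ = N₁ ^ 2 * ((∫ x in (0:ℝ)..1, r x ^ 2) + ∫ x in (0:ℝ)..1, r' x ^ 2) := by
            rw [intervalIntegral.integral_const_mul, intervalIntegral.integral_add hir hir']
        _ ≤ N₁ ^ 2 * H1norm u u' ^ 2 := by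
            rw [hH]
            gcongr
            · exact hu.integral_cosPartialSum_sq_le hm
            · exact integral_sum_sinBasis_sq_le hu.2.1 hu.2.2.1 m
    calc _ ≤ _ := hv.integral_sub_cosPartialSum_sq_le hm
      _ ≤ N₁ ^ 2 * H1norm u u' ^ 2 / (Real.pi * m) ^ 2 := by gcongr
      _ = _ := by ring
  have h := L2norm_add_le (hgc.mul (hu.1.sub hrc.continuousOn))
    ((hgc.mul hrc.continuousOn).sub hρc.continuousOn) (by positivity) (by positivity) hA hB
  convert! h using 1
  · congr 1
    ext x
    simp only [Pi.mul_apply, Pi.sub_apply]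
    ring
  · ring
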